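/- Let ν < 0 and let {Δ_t} be a positive, nonincreasing real sequence with Δ_t → 0. Suppose there exist û > 0 and N ∈ ℕ such that Δ_t^ν − Δ_{t−1}^ν ≥ û for all t > N. Then there exists a constant C > 0 such that Δ_t ≤ C·t^{1/ν} for all t > N. -/

import Mathlib

/-- A sequence whose increments past index `N` are at least `u` grows at least linearly. -/
theorem add_mul_le_of_le_sub_pred {a : ℕ → ℝ} {u : ℝ} {N : ℕ}
    (h : ∀ t, N < t → u ≤ a t - a (t - 1)) (k : ℕ) : a N + k * u ≤ a (N + k) := by
  induction k with
  | zero => simp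
  | succ k ih =>
    have hk := h (N + (k + 1)) (by omega)
    rw [show N + (k + 1) - 1 = N + k by omega] at hk
    push_cast
    linarith

theorem sublinear_rate_from_power_increment (ν : ℝ) (hν : ν < 0)
    (Δ : ℕ → ℝ) (hpos : ∀ t, 0 < Δ t) (hmono : Antitone Δ)
    (hlim : Filter.Tendsto Δ Filter.atTop (nhds 0))
    (u : ℝ) (hu : 0 < u) (N : ℕ)
    (hinc : ∀ t, N < t → Δ t ^ ν - Δ (t - 1) ^ ν ≥ u) :
    ∃ C : ℝ, 0 < C ∧ ∀ t, N < t → Δ t ≤ C * (t : ℝ) ^ (1 / ν) := by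
  have hc : 0 < u / (N + 1) := by positivity
  refine ⟨(u / (N + 1)) ^ (1 / ν), Real.rpow_pos_of_pos hc _, fun t ht => ?_⟩
  have ht0 : (0 : ℝ) < t := by exact_mod_cast (Nat.zero_le N).trans_lt ht
  have hlinear : u / (N + 1) * t ≤ Δ t ^ ν := by
    obtain ⟨k, rfl⟩ := Nat.exists_eq_add_of_lt ht
    have hgrowth := add_mul_le_of_le_sub_pred (a := fun t => Δ t ^ ν) hinc (k + 1)
    have hN := Real.rpow_pos_of_pos (hpos N) ν
    have hratio : u / (N + 1) * ((N + k + 1 : ℕ) : ℝ) ≤ (k + 1) * u := by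
      rw [div_mul_eq_mul_div, div_le_iff₀ (by positivity)]
      push_cast
      have : 0 ≤ u * (N * k) := by positivity
      linarith
    rw [← add_assoc] at hgrowth
    push_cast at hgrowth
    linarith
  calc Δ t = (Δ t ^ ν) ^ (1 / ν) := by
        rw [one_div, Real.rpow_rpow_inv (hpos t).le hν.ne]
    _ ≤ (u / (N + 1) * t) ^ (1 / ν) :=
        Real.rpow_le_rpow_of_nonpos (by positivity) hlinear (one_div_neg.2 hν).le
    _ = (u / (N + 1)) ^ (1 / ν) * (t : ℝ) ^ (1 / ν) := Real.mul_rpow hc.le ht0.le
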